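/- Let (α_n) and (β_n) be sequences with α_n, β_n > −1 such that α_n/n → ∞, β_n/n → ∞ and α_n/β_n → ∞ as n → ∞, and set ε_n = (α_n + 2√(n·β_n) − β_n)/(2n + α_n + β_n). Let r_n and s_n denote, respectively, the smallest and largest zero of P_n^{(α_n,β_n)}. Then lim_{n→∞} (α_n/√(n·β_n))·(s_n + ε_n) = 6 and lim_{n→∞} (α_n/√(n·β_n))·(r_n + ε_n) = −2. Moreover, the closure of the set ⋃_{n≥1} { (α_n/√(n·β_n))·(x + ε_n) : P_n^{(α_n,β_n)}(x) = 0 } contains the interval [−2, 6]. -/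

import Mathlib

open Filter Topology

/-- Generalized binomial coefficient C(t, m) = t(t-1)⋯(t-m+1)/m! for real t. -/
noncomputable def genBinom (t : ℝ) (m : ℕ) : ℝ :=
  (∏ i ∈ Finset.range m, (t - (i : ℝ))) / (Nat.factorial m)

/-- Jacobi polynomial P_n^{(α,β)}. -/
noncomputable def jacobiP (n : ℕ) (α β : ℝ) (x : ℝ) : ℝ :=
  ∑ k ∈ Finset.range (n + 1),
    genBinom ((n : ℝ) + α) (n - k) * genBinom ((n : ℝ) + β) k *
      ((x - 1) / 2) ^ k * ((x + 1) / 2) ^ (n - k)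

/-- Number of zeros of P_n^{(α,β)} that are ≤ ξ. -/
noncomputable def jacobiN (n : ℕ) (α β ξ : ℝ) : ℕ :=
  {x : ℝ | jacobiP n α β x = 0 ∧ x ≤ ξ}.ncard

theorem genBinom_succ_mul (t : ℝ) (m : ℕ) :
    genBinom t (m + 1) * (m + 1) = genBinom t m * (t - m) := by
  unfold genBinom
  rw [Finset.prod_range_succ, Nat.factorial_succ]
  have : (m.factorial : ℝ) ≠ 0 := by positivity
  push_cast
  field_simp

theorem genBinom_pos {t : ℝ} {m : ℕ} (h : (m : ℝ) < t + 1) : 0 < genBinom t m := by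
  refine div_pos (Finset.prod_pos fun i hi => ?_) (by positivity)
  have : (i : ℝ) + 1 ≤ m := by exact_mod_cast Finset.mem_range.mp hi
  linarith

theorem jacobiP_coeff_pos {n k : ℕ} {α β : ℝ} (hα : -1 < α) (hβ : -1 < β) (hk : k ≤ n) :
    0 < genBinom (n + α) (n - k) * genBinom (n + β) k := by
  have h₁ : ((n - k : ℕ) : ℝ) ≤ n := by exact_mod_cast Nat.sub_le n k
  have h₂ : (k : ℝ) ≤ n := by exact_mod_cast hk
  exact mul_pos (genBinom_pos (by linarith)) (genBinom_pos (by linarith))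

theorem jacobiP_pos_of_one_le {n : ℕ} {α β x : ℝ} (hα : -1 < α) (hβ : -1 < β) (hx : 1 ≤ x) :
    0 < jacobiP n α β x := by
  have hA : 0 ≤ (x - 1) / 2 := by linarith
  have hB : 0 < (x + 1) / 2 := by linarith
  refine Finset.sum_pos' (fun k hk => ?_) ⟨0, by simp, ?_⟩
  · have := jacobiP_coeff_pos hα hβ (Nat.lt_succ_iff.mp (Finset.mem_range.mp hk))
    positivity
  · have := jacobiP_coeff_pos (n := n) hα hβ (Nat.zero_le _)
    rw [pow_zero, mul_one]
    positivity

theorem jacobiP_ne_zero_of_le_neg_one {n : ℕ} {α β x : ℝ} (hα : -1 < α) (hβ : -1 < β)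
    (hx : x ≤ -1) : jacobiP n α β x ≠ 0 := by
  have hA : 0 < (1 - x) / 2 := by linarith
  have hB : 0 ≤ (-1 - x) / 2 := by linarith
  have key : jacobiP n α β x = (-1) ^ n * ∑ k ∈ Finset.range (n + 1),
      genBinom (n + α) (n - k) * genBinom (n + β) k * ((1 - x) / 2) ^ k *
        ((-1 - x) / 2) ^ (n - k) := by
    rw [jacobiP, Finset.mul_sum]
    refine Finset.sum_congr rfl fun k hk => ?_
    have hk' : k + (n - k) = n :=
      Nat.add_sub_of_le (Nat.lt_succ_iff.mp (Finset.mem_range.mp hk))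
    have e : ((-1 : ℝ)) ^ n = (-1) ^ k * (-1) ^ (n - k) := by rw [← pow_add, hk']
    rw [e, show (x - 1) / 2 = -1 * ((1 - x) / 2) by ring,
      show (x + 1) / 2 = -1 * ((-1 - x) / 2) by ring, mul_pow, mul_pow]
    ring
  rw [key]
  refine mul_ne_zero (by simp) (ne_of_gt ?_)
  refine Finset.sum_pos' (fun k hk => ?_) ⟨n, by simp, ?_⟩
  · have := jacobiP_coeff_pos hα hβ (Nat.lt_succ_iff.mp (Finset.mem_range.mp hk))
    positivity
  · have := jacobiP_coeff_pos (n := n) hα hβ le_rfl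
    rw [Nat.sub_self, pow_zero, mul_one] at *
    positivity

theorem jacobiP_zero_mem_Ioo {n : ℕ} {α β x : ℝ} (hα : -1 < α) (hβ : -1 < β)
    (hx : jacobiP n α β x = 0) : x ∈ Set.Ioo (-1 : ℝ) 1 := by
  constructor
  · by_contra! h
    exact jacobiP_ne_zero_of_le_neg_one hα hβ h hx
  · by_contra! h
    exact (jacobiP_pos_of_one_le hα hβ h).ne' hx

/-- The product `((x - 1) / 2) ^ k * ((x + 1) / 2) ^ m` out of which Jacobi polynomials are
built. -/
noncomputable def jacobiTerm (k m : ℕ) (x : ℝ) : ℝ := ((x - 1) / 2) ^ k * ((x + 1) / 2) ^ m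

/-- The derivative of `jacobiTerm k m`. -/
noncomputable def jacobiTermDeriv (k m : ℕ) (x : ℝ) : ℝ :=
  k / 2 * jacobiTerm (k - 1) m x + m / 2 * jacobiTerm k (m - 1) x

/-- The second derivative of `jacobiTerm k m`. -/
noncomputable def jacobiTermDeriv₂ (k m : ℕ) (x : ℝ) : ℝ :=
  k / 2 * jacobiTermDeriv (k - 1) m x + m / 2 * jacobiTermDeriv k (m - 1) x

theorem hasDerivAt_jacobiTerm (k m : ℕ) (x : ℝ) :
    HasDerivAt (jacobiTerm k m) (jacobiTermDeriv k m x) x := by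
  have hA : HasDerivAt (fun x : ℝ => (x - 1) / 2) (1 / 2) x :=
    ((hasDerivAt_id x).sub_const 1).div_const 2
  have hB : HasDerivAt (fun x : ℝ => (x + 1) / 2) (1 / 2) x :=
    ((hasDerivAt_id x).add_const 1).div_const 2
  refine ((hA.pow k).mul (hB.pow m)).congr_deriv ?_
  simp only [jacobiTermDeriv, jacobiTerm, Pi.pow_apply]
  ring

theorem hasDerivAt_jacobiTermDeriv (k m : ℕ) (x : ℝ) :
    HasDerivAt (jacobiTermDeriv k m) (jacobiTermDeriv₂ k m x) x :=
  ((hasDerivAt_jacobiTerm (k - 1) m x).const_mul _).add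
    ((hasDerivAt_jacobiTerm k (m - 1) x).const_mul _)

theorem jacobiTerm_ode (k m : ℕ) (α β x : ℝ) :
    (1 - x ^ 2) * jacobiTermDeriv₂ k m x + (β - α - (α + β + 2) * x) * jacobiTermDeriv k m x
      + (k + m) * (k + m + α + β + 1) * jacobiTerm k m x =
    (k * (k + α) + m * (m + β)) * jacobiTerm k m x
      - k * (k + α) * jacobiTerm (k - 1) (m + 1) x
      - m * (m + β) * jacobiTerm (k + 1) (m - 1) x := by
  rcases k with _ | _ | k <;> rcases m with _ | _ | m <;>
    simp [jacobiTermDeriv₂, jacobiTermDeriv, jacobiTerm] <;> ring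

theorem jacobiP_ode (n : ℕ) (α β : ℝ) :
    ∃ y' y'' : ℝ → ℝ, (∀ x, HasDerivAt (jacobiP n α β) (y' x) x) ∧
      (∀ x, HasDerivAt y' (y'' x) x) ∧
      ∀ x, (1 - x ^ 2) * y'' x + (β - α - (α + β + 2) * x) * y' x
        + n * (n + α + β + 1) * jacobiP n α β x = 0 := by
  set c : ℕ → ℝ := fun k => genBinom (n + α) (n - k) * genBinom (n + β) k with hc
  have hP : jacobiP n α β =
      fun x => ∑ k ∈ Finset.range (n + 1), c k * jacobiTerm k (n - k) x := by
    funext x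
    simp only [jacobiP, jacobiTerm, hc, mul_assoc]
  have hrec : ∀ k < n,
      c (k + 1) * ((k + 1) * (k + 1 + α)) = c k * ((n - k : ℕ) * ((n - k : ℕ) + β)) := by
    intro k hk
    obtain ⟨m, rfl⟩ : ∃ m, n = k + 1 + m := Nat.exists_eq_add_of_le hk
    have h₁ := genBinom_succ_mul ((k + 1 + m : ℕ) + α) m
    have h₂ := genBinom_succ_mul ((k + 1 + m : ℕ) + β) k
    have e₁ : k + 1 + m - (k + 1) = m := by omega
    have e₂ : k + 1 + m - k = m + 1 := by omega
    simp only [hc, e₁, e₂]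
    push_cast at h₁ h₂ ⊢
    linear_combination (genBinom (k + 1 + m + α) m * (k + 1 + α)) * h₂
      - (genBinom (k + 1 + m + β) k * (m + 1 + β)) * h₁
  refine ⟨fun x => ∑ k ∈ Finset.range (n + 1), c k * jacobiTermDeriv k (n - k) x,
    fun x => ∑ k ∈ Finset.range (n + 1), c k * jacobiTermDeriv₂ k (n - k) x,
    fun x => ?_, fun x => ?_, fun x => ?_⟩
  · rw [hP]
    exact HasDerivAt.fun_sum fun k _ => (hasDerivAt_jacobiTerm k (n - k) x).const_mul _
  · exact HasDerivAt.fun_sum fun k _ => (hasDerivAt_jacobiTermDeriv k (n - k) x).const_mul _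
  · have down : ∑ k ∈ Finset.range (n + 1),
          c k * (k * (k + α)) * jacobiTerm (k - 1) (n - k + 1) x =
        ∑ k ∈ Finset.range (n + 1),
          c k * ((n - k : ℕ) * ((n - k : ℕ) + β)) * jacobiTerm k (n - k) x := by
      rw [Finset.sum_range_succ', Finset.sum_range_succ (n := n)]
      simp only [Nat.cast_zero, zero_mul, mul_zero, add_zero, Nat.sub_self]
      refine Finset.sum_congr rfl fun k hk => ?_
      have hk := Finset.mem_range.mp hk
      rw [← hrec k hk, show n - (k + 1) + 1 = n - k by omega]
      push_cast
      rfl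
    have up : ∑ k ∈ Finset.range (n + 1),
          c k * ((n - k : ℕ) * ((n - k : ℕ) + β)) * jacobiTerm (k + 1) (n - k - 1) x =
        ∑ k ∈ Finset.range (n + 1), c k * (k * (k + α)) * jacobiTerm k (n - k) x := by
      rw [Finset.sum_range_succ, Finset.sum_range_succ' (n := n)]
      simp only [Nat.cast_zero, zero_mul, mul_zero, add_zero, Nat.sub_self]
      refine Finset.sum_congr rfl fun k hk => ?_
      have hk := Finset.mem_range.mp hk
      rw [← hrec k hk, show n - k - 1 = n - (k + 1) by omega]
      push_cast
      rfl
    rw [hP]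
    simp only [Finset.mul_sum]
    rw [← Finset.sum_add_distrib, ← Finset.sum_add_distrib]
    calc _ = ∑ k ∈ Finset.range (n + 1),
          (c k * (k * (k + α)) * jacobiTerm k (n - k) x
            + c k * ((n - k : ℕ) * ((n - k : ℕ) + β)) * jacobiTerm k (n - k) x
            - c k * (k * (k + α)) * jacobiTerm (k - 1) (n - k + 1) x
            - c k * ((n - k : ℕ) * ((n - k : ℕ) + β)) * jacobiTerm (k + 1) (n - k - 1) x) := by
          refine Finset.sum_congr rfl fun k hk => ?_
          have hn : (n : ℝ) = k + (n - k : ℕ) := by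
            exact_mod_cast
              (Nat.add_sub_of_le (Nat.lt_succ_iff.mp (Finset.mem_range.mp hk))).symm
          have h := jacobiTerm_ode k (n - k) α β x
          rw [← hn] at h
          linear_combination c k * h
      _ = 0 := by
          rw [Finset.sum_sub_distrib, Finset.sum_sub_distrib, Finset.sum_add_distrib, down, up]
          ring

theorem exists_zero_of_sturm {a b K : ℝ} (hab : a < b) {f f' Q : ℝ → ℝ}
    (hK : K = (Real.pi / (b - a)) ^ 2)
    (hf : ∀ x ∈ Set.Icc a b, HasDerivAt f (f' x) x)
    (hf' : ∀ x ∈ Set.Icc a b, HasDerivAt f' (-Q x * f x) x)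
    (hQ : ∀ x ∈ Set.Icc a b, K ≤ Q x) : ∃ x ∈ Set.Icc a b, f x = 0 := by
  by_contra! hne
  wlog hpos : 0 < f a generalizing f f'
  · refine this (f := -f) (f' := -f') (fun x hx => (hf x hx).neg)
      (fun x hx => ((hf' x hx).neg).congr_deriv (by simp)) (fun x hx => by simpa using hne x hx) ?_
    have := hne a ⟨le_rfl, hab.le⟩
    simpa using lt_of_le_of_ne (not_lt.mp hpos) this
  have hcont : ContinuousOn f (Set.Icc a b) := fun x hx => (hf x hx).continuousAt.continuousWithinAt
  have hposI : ∀ x ∈ Set.Icc a b, 0 < f x := by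
    intro x hx
    by_contra! h
    obtain ⟨y, hy, hy0⟩ := intermediate_value_Icc' hx.1
      (hcont.mono (Set.Icc_subset_Icc le_rfl hx.2)) ⟨h, hpos.le⟩
    exact hne y ⟨hy.1, hy.2.trans hx.2⟩ hy0
  have hba : 0 < b - a := sub_pos.mpr hab
  set ω := Real.pi / (b - a) with hω
  have hω0 : 0 < ω := div_pos Real.pi_pos hba
  set g : ℝ → ℝ := fun x => f' x * Real.sin (ω * (x - a)) - f x * (ω * Real.cos (ω * (x - a)))
  have hlin : ∀ x, HasDerivAt (fun x => ω * (x - a)) ω x := fun x => by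
    simpa using ((hasDerivAt_id x).sub_const a).const_mul ω
  have hg : ∀ x ∈ Set.Icc a b,
      HasDerivAt g ((K - Q x) * (f x * Real.sin (ω * (x - a)))) x := by
    intro x hx
    refine (((hf' x hx).mul (hlin x).sin).sub
      ((hf x hx).mul ((hlin x).cos.const_mul ω))).congr_deriv ?_
    rw [hK]
    ring
  have hanti : AntitoneOn g (Set.Icc a b) := by
    refine antitoneOn_of_hasDerivWithinAt_nonpos (convex_Icc a b)
      (fun x hx => (hg x hx).continuousAt.continuousWithinAt)
      (fun x hx => (hg x (interior_subset hx)).hasDerivWithinAt) fun x hx => ?_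
    have hx := interior_subset hx
    have hωx : ω * (x - a) ≤ Real.pi := by
      rw [hω, div_mul_eq_mul_div, div_le_iff₀ hba]
      exact mul_le_mul_of_nonneg_left (by linarith [hx.2]) Real.pi_pos.le
    exact mul_nonpos_of_nonpos_of_nonneg (by linarith [hQ x hx])
      (mul_nonneg (hposI x hx).le
        (Real.sin_nonneg_of_nonneg_of_le_pi (mul_nonneg hω0.le (by linarith [hx.1])) hωx))
  have h := hanti ⟨le_rfl, hab.le⟩ ⟨hab.le, le_rfl⟩ hab.le
  have hb : ω * (b - a) = Real.pi := by rw [hω]; field_simp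
  simp only [g, hb, sub_self, mul_zero, Real.sin_zero, Real.cos_zero, Real.sin_pi, Real.cos_pi] at h
  have h₁ := mul_pos (hposI a ⟨le_rfl, hab.le⟩) hω0
  have h₂ := mul_pos (hposI b ⟨hab.le, le_rfl⟩) hω0
  linarith

theorem exists_zero_of_convex {a b : ℝ} (hab : a < b) {f f' Q : ℝ → ℝ}
    (hcont : ContinuousOn f (Set.Icc a b)) (ha : f a = 0) (hb : f b = 0)
    (hf : ∀ x ∈ Set.Ioo a b, HasDerivAt f (f' x) x)
    (hf' : ∀ x ∈ Set.Ioo a b, HasDerivAt f' (-Q x * f x) x)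
    (hQ : ∀ x ∈ Set.Ioo a b, Q x ≤ 0) : ∃ x ∈ Set.Ioo a b, f x = 0 := by
  by_contra! hne
  obtain ⟨c, hc⟩ := Set.nonempty_Ioo.mpr hab
  wlog hpos : 0 < f c generalizing f f'
  · refine this (f := -f) (f' := -f') hcont.neg (by simp [ha]) (by simp [hb])
      (fun x hx => (hf x hx).neg)
      (fun x hx => ((hf' x hx).neg).congr_deriv (by simp)) (fun x hx => by simpa using hne x hx) ?_
    simpa using lt_of_le_of_ne (not_lt.mp hpos) (hne c hc)
  have hposI : ∀ x ∈ Set.Ioo a b, 0 < f x := by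
    intro x hx
    by_contra! h
    obtain ⟨y, hy, hy0⟩ := (isPreconnected_Ioo.image f
      (hcont.mono Set.Ioo_subset_Icc_self)).ordConnected.out
        (Set.mem_image_of_mem f hx) (Set.mem_image_of_mem f hc) ⟨h, hpos.le⟩
    exact hne y hy hy0
  have hconv : ConvexOn ℝ (Set.Icc a b) f := by
    refine convexOn_of_hasDerivWithinAt2_nonneg (f' := f') (f'' := fun x => -Q x * f x)
      (convex_Icc a b) hcont ?_ ?_ ?_ <;> rw [interior_Icc] <;> intro x hx
    · exact (hf x hx).hasDerivWithinAt
    · exact (hf' x hx).hasDerivWithinAt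
    · exact mul_nonneg (by linarith [hQ x hx]) (hposI x hx).le
  have := hconv.le_max_of_mem_Icc ⟨le_rfl, hab.le⟩ ⟨hab.le, le_rfl⟩ (Set.Ioo_subset_Icc_self hc)
  rw [ha, hb, max_self] at this
  linarith

/-- `4 (1 - x²)² Q(x)`, where `u'' + Q u = 0` is the Liouville normal form of the Jacobi
differential equation. -/
def jacobiQuad (n : ℕ) (α β x : ℝ) : ℝ :=
  (1 - α ^ 2) * (1 + x) ^ 2 + (1 - β ^ 2) * (1 - x) ^ 2
    + (4 * n * (n + α + β + 1) + 2 * (α + 1) * (β + 1)) * (1 - x ^ 2)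

theorem jacobiP_normal_form (n : ℕ) {α β : ℝ} (hα : -1 < α) (hβ : -1 < β) :
    ∃ f f' : ℝ → ℝ, Continuous f ∧ f (-1) = 0 ∧ f 1 = 0 ∧
      (∀ x, jacobiP n α β x = 0 → f x = 0) ∧
      (∀ x ∈ Set.Ioo (-1 : ℝ) 1, f x = 0 → jacobiP n α β x = 0) ∧
      (∀ x ∈ Set.Ioo (-1 : ℝ) 1, HasDerivAt f (f' x) x) ∧
      ∀ x ∈ Set.Ioo (-1 : ℝ) 1,
        HasDerivAt f' (-(jacobiQuad n α β x / (4 * (1 - x ^ 2) ^ 2)) * f x) x := by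
  obtain ⟨y', y'', hy, hy', hode⟩ := jacobiP_ode n α β
  set y := jacobiP n α β
  have hycont : Continuous y := continuous_iff_continuousAt.mpr fun x => (hy x).continuousAt
  set p := (α + 1) / 2 with hp
  set q := (β + 1) / 2 with hq
  have hp0 : 0 < p := by rw [hp]; linarith
  have hq0 : 0 < q := by rw [hq]; linarith
  set w : ℝ → ℝ := fun x => (1 - x) ^ p * (1 + x) ^ q with hw
  set L : ℝ → ℝ := fun x => -(p / (1 - x)) + q / (1 + x) with hL
  have hwcont : Continuous w :=
    ((continuous_const.sub continuous_id).rpow_const fun _ => Or.inr hp0.le).mul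
      ((continuous_const.add continuous_id).rpow_const fun _ => Or.inr hq0.le)
  have hw0 : ∀ x ∈ Set.Ioo (-1 : ℝ) 1, 0 < w x := fun x hx =>
    mul_pos (Real.rpow_pos_of_pos (by linarith [hx.2]) _)
      (Real.rpow_pos_of_pos (by linarith [hx.1]) _)
  have hwd : ∀ x ∈ Set.Ioo (-1 : ℝ) 1, HasDerivAt w (w x * L x) x := by
    intro x hx
    have h₁ : 0 < 1 - x := by linarith [hx.2]
    have h₂ : 0 < 1 + x := by linarith [hx.1]
    have d₁ := ((hasDerivAt_id x).const_sub 1).rpow_const (p := p) (Or.inl h₁.ne')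
    have d₂ := ((hasDerivAt_id x).const_add 1).rpow_const (p := q) (Or.inl h₂.ne')
    refine (d₁.mul d₂).congr_deriv ?_
    simp only [id, hw, hL, Real.rpow_sub_one h₁.ne', Real.rpow_sub_one h₂.ne']
    field_simp
  have hLd : ∀ x ∈ Set.Ioo (-1 : ℝ) 1,
      HasDerivAt L (-(p / (1 - x) ^ 2) - q / (1 + x) ^ 2) x := by
    intro x hx
    have h₁ : 1 - x ≠ 0 := by linarith [hx.2]
    have h₂ : 1 + x ≠ 0 := by linarith [hx.1]
    have d₁ := ((hasDerivAt_const x p).div ((hasDerivAt_id x).const_sub 1) h₁).neg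
    have d₂ := (hasDerivAt_const x q).div ((hasDerivAt_id x).const_add 1) h₂
    refine (d₁.add d₂).congr_deriv ?_
    simp only [id]
    ring
  refine ⟨fun x => w x * y x, fun x => w x * (L x * y x + y' x), hwcont.mul hycont, ?_, ?_,
    fun x hx => by simp [hx], fun x hx h => (mul_eq_zero.mp h).resolve_left (hw0 x hx).ne',
    fun x hx => ?_, fun x hx => ?_⟩
  · simp [hw, Real.zero_rpow hq0.ne']
  · simp [hw, Real.zero_rpow hp0.ne']
  · exact ((hwd x hx).mul (hy x)).congr_deriv (by ring)
  · have h₁ : 1 - x ≠ 0 := by linarith [hx.2]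
    have h₂ : 1 + x ≠ 0 := by linarith [hx.1]
    have h₃ : 1 - x ^ 2 ≠ 0 := by
      rw [show 1 - x ^ 2 = (1 - x) * (1 + x) by ring]
      exact mul_ne_zero h₁ h₂
    refine ((hwd x hx).mul (((hLd x hx).mul (hy x)).add (hy' x))).congr_deriv ?_
    have hy'' : y'' x = -((β - α - (α + β + 2) * x) * y' x + n * (n + α + β + 1) * y x)
        / ((1 - x) * (1 + x)) := by
      rw [eq_div_iff (mul_ne_zero h₁ h₂)]
      linear_combination hode x
    rw [show 1 - x ^ 2 = (1 - x) * (1 + x) by ring, Pi.add_apply, Pi.mul_apply, hy'']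
    simp only [hL, hp, hq, jacobiQuad]
    field_simp
    ring

theorem exists_jacobiP_zero {n : ℕ} {α β a b : ℝ} (hα : -1 < α) (hβ : -1 < β)
    (ha : -1 < a) (hab : a < b) (hb : b < 1)
    (hQ : ∀ x ∈ Set.Icc a b, 4 * (Real.pi / (b - a)) ^ 2 * (1 - x ^ 2) ^ 2 ≤ jacobiQuad n α β x) :
    ∃ x ∈ Set.Icc a b, jacobiP n α β x = 0 := by
  obtain ⟨f, f', -, -, -, -, hz, hf, hf'⟩ := jacobiP_normal_form n hα hβ
  have hsub : Set.Icc a b ⊆ Set.Ioo (-1) 1 := Set.Icc_subset_Ioo ha hb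
  obtain ⟨x, hx, h0⟩ := exists_zero_of_sturm hab rfl (fun x hx => hf x (hsub hx))
    (Q := fun x => jacobiQuad n α β x / (4 * (1 - x ^ 2) ^ 2)) (fun x hx => hf' x (hsub hx))
    (fun x hx => by
      have h := hsub hx
      have : 0 < 1 - x ^ 2 := by nlinarith [h.1, h.2]
      rw [le_div_iff₀ (by positivity)]
      linarith [hQ x hx])
  exact ⟨x, hx, hz x (hsub hx) h0⟩

theorem exists_jacobiQuad_pos_right {n : ℕ} {α β s : ℝ} (hα : -1 < α) (hβ : -1 < β)
    (hs : IsGreatest {x : ℝ | jacobiP n α β x = 0} s) :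
    ∃ x, s < x ∧ 0 < jacobiQuad n α β x := by
  by_contra! hQ
  obtain ⟨f, f', hc, -, h1, hz', hz, hf, hf'⟩ := jacobiP_normal_form n hα hβ
  obtain ⟨hs₁, hs₂⟩ := jacobiP_zero_mem_Ioo hα hβ hs.1
  have hsub : ∀ x ∈ Set.Ioo s 1, x ∈ Set.Ioo (-1) 1 := fun x hx => ⟨hs₁.trans hx.1, hx.2⟩
  obtain ⟨x, hx, h0⟩ := exists_zero_of_convex hs₂ hc.continuousOn (hz' s hs.1) h1
    (fun x hx => hf x (hsub x hx)) (fun x hx => hf' x (hsub x hx))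
    (fun x hx => div_nonpos_of_nonpos_of_nonneg (hQ x hx.1) (by positivity))
  exact absurd (hs.2 (hz x (hsub x hx) h0)) (not_le.mpr hx.1)

theorem exists_jacobiQuad_pos_left {n : ℕ} {α β r : ℝ} (hα : -1 < α) (hβ : -1 < β)
    (hr : IsLeast {x : ℝ | jacobiP n α β x = 0} r) :
    ∃ x, x < r ∧ 0 < jacobiQuad n α β x := by
  by_contra! hQ
  obtain ⟨f, f', hc, h1, -, hz', hz, hf, hf'⟩ := jacobiP_normal_form n hα hβ
  obtain ⟨hr₁, hr₂⟩ := jacobiP_zero_mem_Ioo hα hβ hr.1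
  have hsub : ∀ x ∈ Set.Ioo (-1) r, x ∈ Set.Ioo (-1) 1 := fun x hx => ⟨hx.1, hx.2.trans hr₂⟩
  obtain ⟨x, hx, h0⟩ := exists_zero_of_convex hr₁ hc.continuousOn h1 (hz' r hr.1)
    (fun x hx => hf x (hsub x hx)) (fun x hx => hf' x (hsub x hx))
    (fun x hx => div_nonpos_of_nonpos_of_nonneg (hQ x hx.2) (by positivity))
  exact absurd (hr.2 (hz x (hsub x hx) h0)) (not_le.mpr hx.2)

/-- Limits of `n / α`, `n / β`, `β / α`, `1 / n`, `√(n β) / β` and of the eventual signs,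
on which all asymptotics rest. -/
theorem growth_limits {α β : ℕ → ℝ}
    (hαlim : Tendsto (fun n : ℕ => α n / n) atTop atTop)
    (hβlim : Tendsto (fun n : ℕ => β n / n) atTop atTop)
    (hq : Tendsto (fun n : ℕ => α n / β n) atTop atTop) :
    (∀ᶠ n : ℕ in atTop, 0 < (n : ℝ) ∧ 0 < α n ∧ 0 < β n) ∧
    Tendsto (fun n : ℕ => (n : ℝ) / α n) atTop (𝓝 0) ∧
    Tendsto (fun n : ℕ => (n : ℝ) / β n) atTop (𝓝 0) ∧
    Tendsto (fun n : ℕ => β n / α n) atTop (𝓝 0) ∧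
    Tendsto (fun n : ℕ => 1 / (n : ℝ)) atTop (𝓝 0) ∧
    Tendsto (fun n : ℕ => √(n * β n) / β n) atTop (𝓝 0) := by
  have hpos : ∀ᶠ n : ℕ in atTop, 0 < (n : ℝ) ∧ 0 < α n ∧ 0 < β n := by
    filter_upwards [eventually_gt_atTop 0, hαlim.eventually_gt_atTop 0,
      hβlim.eventually_gt_atTop 0] with n hn h₁ h₂
    have hn : (0 : ℝ) < n := by exact_mod_cast hn
    exact ⟨hn, (div_pos_iff_of_pos_right hn).mp h₁, (div_pos_iff_of_pos_right hn).mp h₂⟩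
  have hb : Tendsto (fun n : ℕ => (n : ℝ) / β n) atTop (𝓝 0) := by
    simpa [Pi.inv_def] using hβlim.inv_tendsto_atTop
  refine ⟨hpos, by simpa [Pi.inv_def] using hαlim.inv_tendsto_atTop, hb,
    by simpa [Pi.inv_def] using hq.inv_tendsto_atTop, tendsto_one_div_atTop_nhds_zero_nat, ?_⟩
  have := (Real.continuous_sqrt.tendsto 0).comp hb
  rw [Real.sqrt_zero] at this
  refine this.congr' ?_
  filter_upwards [hpos] with n ⟨hn, _, hβ⟩
  rw [Function.comp, Real.sqrt_div hn.le, Real.sqrt_mul hn.le]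
  have h : √(β n) ≠ 0 := (Real.sqrt_pos.mpr hβ).ne'
  rw [div_eq_div_iff h hβ.ne', mul_assoc, Real.mul_self_sqrt hβ.le]

theorem jacobiQuad_rescaled {n : ℕ} {α β g : ℝ} (u : ℝ) (hα : 0 < α) (hβ : 0 < β) (hg : 0 < g) :
    jacobiQuad n α β (-((α + 2 * g - β) / (2 * n + α + β)) + g / α * u) =
      g ^ 2 * (-(((2 * n + α + β) ^ 2 + 2 * (2 * n + α + β)) / α ^ 2) * u ^ 2
        + 2 * ((2 * n + 2) * (α - β) + 2 * (2 * n + α + β + 2) * g) / (α * g) * u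
        + ((4 * n + 2) * (4 * (n + α) * (n + β)) - 8 * (α - β) * g * (n + 1)
          - 4 * (2 * n + α + β + 2) * g ^ 2 - 4 * n ^ 2 * (2 * n + α + β)
          + 4 * (2 * n + α + β)) / ((2 * n + α + β) * g ^ 2)) := by
  have hN : 2 * n + α + β ≠ 0 := by positivity
  unfold jacobiQuad
  field_simp
  ring

theorem jacobiQuad_limit {α β : ℕ → ℝ}
    (hαlim : Tendsto (fun n : ℕ => α n / n) atTop atTop)
    (hβlim : Tendsto (fun n : ℕ => β n / n) atTop atTop)
    (hq : Tendsto (fun n : ℕ => α n / β n) atTop atTop) :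
    ∃ A B C : ℕ → ℝ, Tendsto A atTop (𝓝 (-1)) ∧ Tendsto B atTop (𝓝 4) ∧
      Tendsto C atTop (𝓝 12) ∧
      ∀ᶠ n : ℕ in atTop, ∀ u : ℝ,
        jacobiQuad n (α n) (β n)
          (-((α n + 2 * √(n * β n) - β n) / (2 * n + α n + β n)) + √(n * β n) / α n * u) =
        n * β n * (A n * u ^ 2 + B n * u + C n) := by
  obtain ⟨hpos, ha, hb, hq, hi, hσ⟩ := growth_limits hαlim hβlim hq
  set a : ℕ → ℝ := fun n => (n : ℝ) / α n
  set b : ℕ → ℝ := fun n => (n : ℝ) / β n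
  set q : ℕ → ℝ := fun n => β n / α n
  set i : ℕ → ℝ := fun n => 1 / (n : ℝ)
  set σ : ℕ → ℝ := fun n => √(n * β n) / β n
  set ν : ℕ → ℝ := fun n => 1 + 2 * a n + q n with hνdef
  have hν : Tendsto ν atTop (𝓝 1) := by
    simpa using (tendsto_const_nhds (x := (1 : ℝ)).add (ha.const_mul 2)).add hq
  have hνi : Tendsto (fun n => (ν n)⁻¹) atTop (𝓝 1) := by simpa using hν.inv₀ one_ne_zero
  refine ⟨fun n => -(ν n ^ 2 + 2 * ν n * (a n * i n)),
    fun n => 2 * ((2 + 2 * i n) * (1 - q n) * σ n + 2 * (ν n + 2 * (a n * i n))),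
    fun n => (4 + 2 * i n) * 4 * ((1 + a n) * (ν n)⁻¹) * (1 + b n)
      - 8 * ((1 - q n) * (ν n)⁻¹) * (σ n * (1 + i n)) - 4 * (1 + 2 * (a n * i n) * (ν n)⁻¹)
      - 4 * b n + 4 * b n * i n ^ 2, ?_, ?_, ?_, ?_⟩
  · have := ((hν.pow 2).add ((hν.const_mul 2).mul (ha.mul hi))).neg
    norm_num at this ⊢
    exact this
  · have := ((((hi.const_mul 2).const_add 2).mul (hq.const_sub 1)).mul hσ |>.add
      ((hν.add ((ha.mul hi).const_mul 2)).const_mul 2)).const_mul 2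
    norm_num at this ⊢
    exact this
  · have := (((((((hi.const_mul 2).const_add 4).mul_const 4).mul
        ((ha.const_add 1).mul hνi)).mul (hb.const_add 1)).sub
      ((((hq.const_sub 1).mul hνi).const_mul 8).mul (hσ.mul (hi.const_add 1)))).sub
      (((((ha.mul hi).const_mul 2).mul hνi).const_add 1).const_mul 4)).sub
      (hb.const_mul 4) |>.add ((hb.const_mul 4).mul (hi.pow 2))
    norm_num at this ⊢
    exact this
  · filter_upwards [hpos] with n ⟨hn, hα, hβ⟩ u
    have hnβ : 0 < n * β n := mul_pos hn hβ
    have hg := Real.sqrt_pos.mpr hnβ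
    have hg2 := Real.sq_sqrt hnβ.le
    rw [jacobiQuad_rescaled u hα hβ hg]
    simp only [a, b, q, i, σ, ν]
    generalize √(n * β n) = g at *
    have hβ' : β n = g ^ 2 / n := by rw [hg2]; field_simp
    have hN : 2 * n + α n + β n ≠ 0 := by positivity
    have hN' : 1 + 2 * (n / α n) + β n / α n = (2 * n + α n + β n) / α n := by field_simp; ring
    rw [hN']
    rw [hβ'] at hN ⊢
    have hN'' : 2 * (n : ℝ) ^ 2 + n * α n + g ^ 2 ≠ 0 := by positivity
    field_simp
    ring

theorem eventually_jacobiQuad_nonpos {α β : ℕ → ℝ}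
    (hαlim : Tendsto (fun n : ℕ => α n / n) atTop atTop)
    (hβlim : Tendsto (fun n : ℕ => β n / n) atTop atTop)
    (hq : Tendsto (fun n : ℕ => α n / β n) atTop atTop) {δ : ℝ} (hδ : 0 < δ) :
    ∀ᶠ n : ℕ in atTop, ∀ u : ℝ, (6 + δ ≤ u ∨ u ≤ -2 - δ) →
      jacobiQuad n (α n) (β n)
        (-((α n + 2 * √(n * β n) - β n) / (2 * n + α n + β n)) + √(n * β n) / α n * u) ≤ 0 := by
  obtain ⟨A, B, C, hA, hB, hC, hABC⟩ := jacobiQuad_limit hαlim hβlim hq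
  have hval : ∀ c : ℝ, Tendsto (fun n => A n * c ^ 2 + B n * c + C n) atTop
      (𝓝 (-1 * c ^ 2 + 4 * c + 12)) := fun c => ((hA.mul_const _).add (hB.mul_const _)).add hC
  have hder : ∀ c : ℝ, Tendsto (fun n => 2 * c * A n + B n) atTop (𝓝 (2 * c * -1 + 4)) :=
    fun c => (hA.const_mul _).add hB
  filter_upwards [hABC, (growth_limits hαlim hβlim hq).1,
    hA.eventually_lt_const (show (-1 : ℝ) < 0 by norm_num),
    (hval (6 + δ)).eventually_lt_const (show _ < (0 : ℝ) by nlinarith),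
    (hval (-2 - δ)).eventually_lt_const (show _ < (0 : ℝ) by nlinarith),
    (hder (6 + δ)).eventually_lt_const (show _ < (0 : ℝ) by linarith),
    (hder (-2 - δ)).eventually_const_lt (show (0 : ℝ) < _ by linarith)]
    with n h ⟨hn, _, hβ⟩ hAn hv₁ hv₂ hd₁ hd₂ u hu
  rw [h u]
  refine mul_nonpos_of_nonneg_of_nonpos (mul_pos hn hβ).le ?_
  rcases hu with hu | hu
  · linarith [mul_nonneg (sub_nonneg.mpr hu) (neg_nonneg.mpr hd₁.le),
      mul_nonneg (neg_nonneg.mpr hAn.le) (sq_nonneg (u - (6 + δ)))]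
  · linarith [mul_nonneg (sub_nonneg.mpr hu) hd₂.le,
      mul_nonneg (neg_nonneg.mpr hAn.le) (sq_nonneg (u - (-2 - δ)))]

theorem eventually_le_jacobiQuad {α β : ℕ → ℝ}
    (hαlim : Tendsto (fun n : ℕ => α n / n) atTop atTop)
    (hβlim : Tendsto (fun n : ℕ => β n / n) atTop atTop)
    (hq : Tendsto (fun n : ℕ => α n / β n) atTop atTop) {u₁ u₂ : ℝ}
    (h₁ : -2 < u₁) (h₁₂ : u₁ < u₂) (h₂ : u₂ < 6) :
    ∃ κ > 0, ∀ᶠ n : ℕ in atTop, ∀ u ∈ Set.Icc u₁ u₂,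
      n * β n * κ ≤ jacobiQuad n (α n) (β n)
        (-((α n + 2 * √(n * β n) - β n) / (2 * n + α n + β n)) + √(n * β n) / α n * u) := by
  obtain ⟨A, B, C, hA, hB, hC, hABC⟩ := jacobiQuad_limit hαlim hβlim hq
  have hval : ∀ c : ℝ, Tendsto (fun n => A n * c ^ 2 + B n * c + C n) atTop
      (𝓝 (-1 * c ^ 2 + 4 * c + 12)) := fun c => ((hA.mul_const _).add (hB.mul_const _)).add hC
  have hκ : 0 < (u₁ + 2) * (6 - u₂) := mul_pos (by linarith) (by linarith)
  refine ⟨_, hκ, ?_⟩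
  filter_upwards [hABC, (growth_limits hαlim hβlim hq).1,
    hA.eventually_lt_const (show (-1 : ℝ) < 0 by norm_num),
    (hval u₁).eventually_const_lt (show (u₁ + 2) * (6 - u₂) < _ by nlinarith),
    (hval u₂).eventually_const_lt (show (u₁ + 2) * (6 - u₂) < _ by nlinarith)]
    with n h ⟨hn, _, hβ⟩ hAn hv₁ hv₂ u hu
  rw [h u]
  refine mul_le_mul_of_nonneg_left ?_ (mul_pos hn hβ).le
  have hu₁ := sub_nonneg.mpr hu.1
  have hu₂ := sub_nonneg.mpr hu.2
  have hconc := mul_nonneg (mul_nonneg (neg_nonneg.mpr hAn.le) (mul_nonneg hu₁ hu₂))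
    (sub_nonneg.mpr h₁₂.le)
  refine le_of_mul_le_mul_right ?_ (sub_pos.mpr h₁₂)
  linarith [mul_nonneg (sub_nonneg.mpr hv₁.le) hu₂, mul_nonneg (sub_nonneg.mpr hv₂.le) hu₁]

theorem eventually_exists_jacobiP_zero {α β : ℕ → ℝ} (hα : ∀ n, α n > -1) (hβ : ∀ n, β n > -1)
    (hαlim : Tendsto (fun n : ℕ => α n / n) atTop atTop)
    (hβlim : Tendsto (fun n : ℕ => β n / n) atTop atTop)
    (hq : Tendsto (fun n : ℕ => α n / β n) atTop atTop) {u₁ u₂ : ℝ}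
    (h₁ : -2 < u₁) (h₁₂ : u₁ < u₂) (h₂ : u₂ < 6) :
    ∀ᶠ n : ℕ in atTop, ∃ u ∈ Set.Icc u₁ u₂, jacobiP n (α n) (β n)
      (-((α n + 2 * √(n * β n) - β n) / (2 * n + α n + β n)) + √(n * β n) / α n * u) = 0 := by
  obtain ⟨κ, hκ, hquad⟩ := eventually_le_jacobiQuad hαlim hβlim hq h₁ h₁₂ h₂
  obtain ⟨hpos, ha, hb, hqi, -, hσ⟩ := growth_limits hαlim hβlim hq
  have hedge : ∀ u : ℝ, Tendsto (fun n : ℕ =>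
      (2 * (n / β n) + 2 - 2 * (√(n * β n) / β n)) * (1 + 2 * (n / α n) + β n / α n)⁻¹
        + √(n * β n) / β n * u) atTop (𝓝 2) := fun u => by
    have := ((((hb.const_mul 2).add_const 2).sub (hσ.const_mul 2)).mul
      ((((ha.const_mul 2).const_add 1).add hqi).inv₀ (by norm_num))).add (hσ.mul_const u)
    norm_num at this ⊢
    exact this
  have hlarge : Tendsto (fun n : ℕ => (n : ℝ) ^ 2) atTop atTop :=
    (tendsto_pow_atTop two_ne_zero).comp tendsto_natCast_atTop_atTop
  filter_upwards [hquad, hpos, (hedge u₁).eventually_const_lt (show (0 : ℝ) < 2 by norm_num),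
    (hedge u₂).eventually_lt_const (show (2 : ℝ) < 3 by norm_num),
    hqi.eventually_lt_const (show (0 : ℝ) < 1 / 3 by norm_num),
    hlarge.eventually_ge_atTop (144 * Real.pi ^ 2 / (κ * (u₂ - u₁) ^ 2))]
    with n hquad ⟨hn, hα₀, hβ₀⟩ he₁ he₂ hq₃ hlarge
  have hnβ : 0 < n * β n := mul_pos hn hβ₀
  have hg := Real.sqrt_pos.mpr hnβ
  have hg2 := Real.sq_sqrt hnβ.le
  have hℓ : 0 < u₂ - u₁ := sub_pos.mpr h₁₂
  set g := √(n * β n)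
  set e := (α n + 2 * g - β n) / (2 * n + α n + β n) with he
  have hh : 0 < g / α n := div_pos hg hα₀
  have hx : ∀ u, (1 + (-e + g / α n * u)) = β n / α n *
      ((2 * (n / β n) + 2 - 2 * (g / β n)) * (1 + 2 * (n / α n) + β n / α n)⁻¹
        + g / β n * u) := by
    intro u
    have hN : 2 * n + α n + β n ≠ 0 := by positivity
    have hN' : 1 + 2 * (n / α n) + β n / α n = (2 * n + α n + β n) / α n := by field_simp; ring
    rw [hN', he]
    field_simp
    ring
  have hq₀ : 0 < β n / α n := div_pos hβ₀ hα₀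
  have hlow : 0 < 1 + (-e + g / α n * u₁) := hx u₁ ▸ mul_pos hq₀ he₁
  have hup : 1 + (-e + g / α n * u₂) ≤ 3 * (β n / α n) := by
    rw [hx u₂, mul_comm 3]
    exact mul_le_mul_of_nonneg_left he₂.le hq₀.le
  obtain ⟨x, hxI, hx0⟩ := exists_jacobiP_zero (hα n) (hβ n) (a := -e + g / α n * u₁)
    (b := -e + g / α n * u₂) (by linarith) (by gcongr) (by linarith) (fun x hx => by
      have hxu : x = -e + g / α n * ((x + e) / (g / α n)) := by
        rw [mul_div_cancel₀ _ hh.ne']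
        ring
      have hbound : (1 - x ^ 2) ^ 2 ≤ (6 * (β n / α n)) ^ 2 := by
        have h₁ : 0 ≤ 1 + x := by linarith [hx.1]
        have h₂ : 1 + x ≤ 3 * (β n / α n) := by linarith [hx.2]
        have h₃ : 0 ≤ 1 - x := by linarith
        refine pow_le_pow_left₀ (by nlinarith) ?_ 2
        nlinarith
      calc 4 * (Real.pi / (-e + g / α n * u₂ - (-e + g / α n * u₁))) ^ 2 * (1 - x ^ 2) ^ 2
          ≤ 4 * (Real.pi / (-e + g / α n * u₂ - (-e + g / α n * u₁))) ^ 2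
              * (6 * (β n / α n)) ^ 2 := mul_le_mul_of_nonneg_left hbound (by positivity)
        _ = 144 * Real.pi ^ 2 / (κ * (u₂ - u₁) ^ 2) * (β n ^ 2 * κ / g ^ 2) := by
            rw [show -e + g / α n * u₂ - (-e + g / α n * u₁) = g / α n * (u₂ - u₁) by ring]
            field_simp
            ring
        _ ≤ n ^ 2 * (β n ^ 2 * κ / g ^ 2) :=
            mul_le_mul_of_nonneg_right hlarge (by positivity)
        _ = n * β n * κ := by
            rw [hg2]
            field_simp
        _ ≤ jacobiQuad n (α n) (β n) x := by
            rw [hxu]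
            refine hquad _ ⟨?_, ?_⟩
            · rw [le_div_iff₀ hh]
              linarith [hx.1]
            · rw [div_le_iff₀ hh]
              linarith [hx.2])
  refine ⟨(x + e) / (g / α n), ⟨?_, ?_⟩, ?_⟩
  · rw [le_div_iff₀ hh]
    linarith [hxI.1]
  · rw [div_le_iff₀ hh]
    linarith [hxI.2]
  · rw [mul_div_cancel₀ _ hh.ne']
    simpa using hx0

theorem stmt12 (α β : ℕ → ℝ)
    (hα : ∀ n, α n > -1) (hβ : ∀ n, β n > -1)
    (hαlim : Tendsto (fun n : ℕ => α n / n) atTop atTop)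
    (hβlim : Tendsto (fun n : ℕ => β n / n) atTop atTop)
    (hq : Tendsto (fun n : ℕ => α n / β n) atTop atTop)
    (ε : ℕ → ℝ)
    (hε : ∀ n : ℕ, ε n = (α n + 2 * Real.sqrt ((n : ℝ) * β n) - β n) /
      (2 * (n : ℝ) + α n + β n))
    (r s : ℕ → ℝ)
    (hr : ∀ n : ℕ, 1 ≤ n → IsLeast {x : ℝ | jacobiP n (α n) (β n) x = 0} (r n))
    (hs : ∀ n : ℕ, 1 ≤ n → IsGreatest {x : ℝ | jacobiP n (α n) (β n) x = 0} (s n)) :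
    Tendsto (fun n : ℕ => α n / Real.sqrt ((n : ℝ) * β n) * (s n + ε n))
      atTop (𝓝 6) ∧
    Tendsto (fun n : ℕ => α n / Real.sqrt ((n : ℝ) * β n) * (r n + ε n))
      atTop (𝓝 (-2)) ∧
    Set.Icc (-2 : ℝ) 6 ⊆
      closure (⋃ n : ℕ, ⋃ _ : 1 ≤ n,
        (fun x => α n / Real.sqrt ((n : ℝ) * β n) * (x + ε n)) ''
          {x : ℝ | jacobiP n (α n) (β n) x = 0}) := by
  have hpos := (growth_limits hαlim hβlim hq).1
  set t : ℕ → ℝ → ℝ := fun n x => α n / √(n * β n) * (x + ε n) with ht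
  have hcancel : ∀ᶠ n : ℕ in atTop, 0 < √(n * β n) / α n ∧
      (∀ u, t n (-ε n + √(n * β n) / α n * u) = u) ∧
      ∀ x, -ε n + √(n * β n) / α n * t n x = x := by
    filter_upwards [hpos] with n ⟨hn, hα₀, hβ₀⟩
    have hg := Real.sqrt_pos.mpr (mul_pos hn hβ₀)
    refine ⟨div_pos hg hα₀, fun u => ?_, fun x => ?_⟩
    · simp only [ht]
      field_simp
      ring
    · simp only [ht]
      field_simp
      ring
  have hzero : ∀ u₁ u₂ : ℝ, -2 < u₁ → u₁ < u₂ → u₂ < 6 → ∀ᶠ n : ℕ in atTop,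
      1 ≤ n ∧ ∃ x, jacobiP n (α n) (β n) x = 0 ∧ t n x ∈ Set.Icc u₁ u₂ := by
    intro u₁ u₂ h₁ h₁₂ h₂
    filter_upwards [hcancel, eventually_ge_atTop 1,
      eventually_exists_jacobiP_zero hα hβ hαlim hβlim hq h₁ h₁₂ h₂]
      with n ⟨_, htu, _⟩ hn ⟨u, hu, h0⟩
    rw [← hε n] at h0
    exact ⟨hn, _, h0, by rwa [htu u]⟩
  have hmono : ∀ᶠ n : ℕ in atTop, Monotone (t n) := by
    filter_upwards [hpos] with n ⟨hn, hα₀, hβ₀⟩ x y hxy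
    exact mul_le_mul_of_nonneg_left (by linarith) (by positivity)
  refine ⟨?_, ?_, ?_⟩
  · refine tendsto_order.mpr ⟨fun c hc => ?_, fun c hc => ?_⟩
    · obtain ⟨u₁, h₁, h₁'⟩ := exists_between (max_lt (show (-2 : ℝ) < 6 by norm_num) hc)
      obtain ⟨u₂, h₂, h₂'⟩ := exists_between h₁'
      obtain ⟨h₁, hc⟩ := max_lt_iff.mp h₁
      filter_upwards [hzero u₁ u₂ h₁ h₂ h₂', hmono] with n ⟨hn, x, hx, hxu⟩ hm
      exact (hc.trans_le hxu.1).trans_le (hm ((hs n hn).2 hx))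
    · filter_upwards [hcancel, eventually_ge_atTop 1,
        eventually_jacobiQuad_nonpos hαlim hβlim hq (sub_pos.mpr hc)] with n ⟨hh, _, htx⟩ hn hQ
      by_contra! hle
      obtain ⟨x, hx, hx0⟩ := exists_jacobiQuad_pos_right (hα n) (hβ n) (hs n hn)
      have hlt : t n (s n) < t n x := by
        rw [← htx (s n), ← htx x] at hx
        exact lt_of_mul_lt_mul_left (by linarith) hh.le
      have := hQ (t n x) (Or.inl (by linarith))
      rw [← hε n, htx x] at this
      linarith
  · refine tendsto_order.mpr ⟨fun c hc => ?_, fun c hc => ?_⟩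
    · filter_upwards [hcancel, eventually_ge_atTop 1,
        eventually_jacobiQuad_nonpos hαlim hβlim hq (sub_pos.mpr hc)] with n ⟨hh, _, htx⟩ hn hQ
      by_contra! hle
      obtain ⟨x, hx, hx0⟩ := exists_jacobiQuad_pos_left (hα n) (hβ n) (hr n hn)
      have hlt : t n x < t n (r n) := by
        rw [← htx (r n), ← htx x] at hx
        exact lt_of_mul_lt_mul_left (by linarith) hh.le
      have := hQ (t n x) (Or.inr (by linarith))
      rw [← hε n, htx x] at this
      linarith
    · obtain ⟨u₁, h₁, h₁'⟩ := exists_between (lt_min (show (-2 : ℝ) < 6 by norm_num) hc)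
      obtain ⟨u₂, h₂, h₂'⟩ := exists_between h₁'
      obtain ⟨h₂', hc⟩ := lt_min_iff.mp h₂'
      filter_upwards [hzero u₁ u₂ h₁ h₂ h₂', hmono] with n ⟨hn, x, hx, hxu⟩ hm
      exact (hm ((hr n hn).2 hx)).trans_lt (hxu.2.trans_lt hc)
  · rw [← closure_Ioo (show (-2 : ℝ) ≠ 6 by norm_num)]
    refine closure_minimal (fun c hc => Metric.mem_closure_iff.mpr fun δ hδ => ?_) isClosed_closure
    obtain ⟨u₂, h₂, h₂'⟩ := exists_between (lt_min hc.2 (lt_add_of_pos_right c hδ))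
    obtain ⟨h₂6, h₂δ⟩ := lt_min_iff.mp h₂'
    obtain ⟨n, hn, x, hx, hxu⟩ := (hzero c u₂ hc.1 h₂ h₂6).exists
    refine ⟨t n x, Set.mem_iUnion₂.mpr ⟨n, hn, x, hx, rfl⟩, ?_⟩
    rw [dist_comm, Real.dist_eq, abs_lt]
    constructor <;> linarith [hxu.1, hxu.2]
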